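/- Let P and S be symmetric positive definite matrices, M a matrix, and define Σ = M P Mᵀ + S, Γ₁ = (P⁻¹ + Mᵀ S⁻¹ M)⁻¹, and x̂₁ = z + Γ₁ Mᵀ S⁻¹ (y − M z). Then for all vectors x, y, z: (x−z)ᵀ P⁻¹ (x−z) + (y−Mx)ᵀ S⁻¹ (y−Mx) = (x−x̂₁)ᵀ Γ₁⁻¹ (x−x̂₁) + (y−Mz)ᵀ Σ⁻¹ (y−Mz). -/

import Mathlib

open Matrix

/-- Identity (A.1): completing the square for the measurement update (state-space form). -/
theorem stmt_0 {n m : ℕ}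
    (P : Matrix (Fin n) (Fin n) ℝ) (S : Matrix (Fin m) (Fin m) ℝ)
    (M : Matrix (Fin m) (Fin n) ℝ)
    (hP : P.PosDef) (hS : S.PosDef)
    (x z : Fin n → ℝ) (y : Fin m → ℝ) :
    (x - z) ⬝ᵥ (P⁻¹ *ᵥ (x - z)) + (y - M *ᵥ x) ⬝ᵥ (S⁻¹ *ᵥ (y - M *ᵥ x)) =
      (x - (z + (P⁻¹ + Mᵀ * S⁻¹ * M)⁻¹ *ᵥ (Mᵀ *ᵥ (S⁻¹ *ᵥ (y - M *ᵥ z))))) ⬝ᵥ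
        (((P⁻¹ + Mᵀ * S⁻¹ * M)⁻¹)⁻¹ *ᵥ
          (x - (z + (P⁻¹ + Mᵀ * S⁻¹ * M)⁻¹ *ᵥ (Mᵀ *ᵥ (S⁻¹ *ᵥ (y - M *ᵥ z)))))) +
      (y - M *ᵥ z) ⬝ᵥ ((M * P * Mᵀ + S)⁻¹ *ᵥ (y - M *ᵥ z)) := by
  have hSi := hS.inv
  have hSt : (S⁻¹)ᵀ = S⁻¹ := by
    rw [← conjTranspose_eq_transpose_of_trivial]; exact hSi.isHermitian.eq
  have hPt : (P⁻¹)ᵀ = P⁻¹ := by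
    rw [← conjTranspose_eq_transpose_of_trivial]; exact hP.inv.isHermitian.eq
  have hK : (P⁻¹ + Mᵀ * S⁻¹ * M).PosDef := by
    refine hP.inv.add_posSemidef ?_
    simpa using hSi.posSemidef.conjTranspose_mul_mul_same M
  have hW : (M * P * Mᵀ + S)⁻¹ =
      S⁻¹ - S⁻¹ * M * (P⁻¹ + Mᵀ * S⁻¹ * M)⁻¹ * Mᵀ * S⁻¹ := by
    rw [add_comm (M * P * Mᵀ) S]
    exact add_mul_mul_inv_eq_sub S M P Mᵀ hS.isUnit hP.isUnit hK.isUnit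
  rw [hW]
  have hdet := (isUnit_iff_isUnit_det _).1 hK.isUnit
  rw [nonsing_inv_nonsing_inv _ hdet]
  have hKt : (P⁻¹ + Mᵀ * S⁻¹ * M)ᵀ = P⁻¹ + Mᵀ * S⁻¹ * M := by
    simp [transpose_mul, hSt, hPt, Matrix.mul_assoc]
  generalize hKe : P⁻¹ + Mᵀ * S⁻¹ * M = K at *
  have hx : y - M *ᵥ x = (y - M *ᵥ z) - M *ᵥ (x - z) := by
    rw [mulVec_sub]; abel
  rw [hx, ← sub_sub]
  generalize y - M *ᵥ z = d
  generalize x - z = u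
  obtain ⟨b, hb⟩ : ∃ b, b = Mᵀ *ᵥ (S⁻¹ *ᵥ d) := ⟨_, rfl⟩
  obtain ⟨g, hg⟩ : ∃ g, g = K⁻¹ *ᵥ b := ⟨_, rfl⟩
  have hKg : K *ᵥ g = b := by
    rw [hg, mulVec_mulVec, mul_nonsing_inv _ hdet, one_mulVec]
  have sw : ∀ {k l : ℕ} (A : Matrix (Fin k) (Fin l) ℝ) (v : Fin k → ℝ) (w : Fin l → ℝ),
      v ⬝ᵥ (A *ᵥ w) = w ⬝ᵥ (Aᵀ *ᵥ v) := by
    intro k l A v w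
    rw [dotProduct_mulVec, mulVec_transpose, dotProduct_comm]
  have e1 : (S⁻¹ - S⁻¹ * M * K⁻¹ * Mᵀ * S⁻¹) *ᵥ d = S⁻¹ *ᵥ d - S⁻¹ *ᵥ (M *ᵥ g) := by
    rw [hg, hb]; simp [sub_mulVec, mulVec_mulVec, Matrix.mul_assoc]
  have e2 : d ⬝ᵥ (S⁻¹ *ᵥ (M *ᵥ g)) = g ⬝ᵥ b := by
    rw [mulVec_mulVec, sw, transpose_mul, hSt, ← mulVec_mulVec, hb]
  have e3 : d ⬝ᵥ (S⁻¹ *ᵥ (M *ᵥ u)) = u ⬝ᵥ b := by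
    rw [mulVec_mulVec, sw, transpose_mul, hSt, ← mulVec_mulVec, hb]
  have e4 : (M *ᵥ u) ⬝ᵥ (S⁻¹ *ᵥ d) = u ⬝ᵥ b := by
    rw [sw, hSt, e3]
  have e5 : g ⬝ᵥ (K *ᵥ u) = u ⬝ᵥ b := by
    rw [sw, hKt, hKg]
  have e6 : u ⬝ᵥ (K *ᵥ u) = u ⬝ᵥ (P⁻¹ *ᵥ u) + (M *ᵥ u) ⬝ᵥ (S⁻¹ *ᵥ (M *ᵥ u)) := by
    rw [← hKe, add_mulVec, dotProduct_add, dotProduct_comm (M *ᵥ u), sw M]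
    simp only [mulVec_mulVec, Matrix.mul_assoc]
  rw [← hb, ← hg, e1]
  simp only [mulVec_sub, sub_dotProduct, dotProduct_sub, e2, e3, e4, e5, e6, hKg]
  ring
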